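/- arXiv:1510.00218 — 3 statements merged into one kernel-verified Lean document; each statement's English description precedes it below -/
import Mathlib

section
/- Let (K, D) be a model of W_e-DCF. Then for every multi-index 𝐢 ∈ ℕ^e with 𝐢 ≠ (0,…,0), the p^e-fold composition D_𝐢^(p^e) is the zero map on K. -/
noncomputable section

open scoped BigOperators

/-- The `m`-th Witt addition polynomial with coefficients reduced mod `p`. -/
def wittHmod (p : ℕ) [Fact p.Prime] (m : ℕ) : MvPolynomial (Fin 2 × ℕ) (ZMod p) :=
  MvPolynomial.map (Int.castRingHom (ZMod p)) (WittVector.wittAdd p m)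

/-- The exponent (as a finitely supported function) of the monomial `X̄^i * Ȳ^j`,
where `X_{m+1}` is the variable `(0, m)` and `Y_{m+1}` is the variable `(1, m)`. -/
def xyExp (e : ℕ) (i j : Fin e → ℕ) : (Fin 2 × ℕ) →₀ ℕ :=
  ∑ m : Fin e, (Finsupp.single ((0 : Fin 2), (m : ℕ)) (i m) +
    Finsupp.single ((1 : Fin 2), (m : ℕ)) (j m))

/-- `wittAlpha p e i j l` is the coefficient `α_{i,j}(l) ∈ 𝔽_p` of the monomial `X̄^i * Ȳ^j` in
`H_1^{l_1} ⋯ H_e^{l_e}`, where `H_1, …, H_e` are the polynomials giving the group law of the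
`e`-dimensional Witt group over `𝔽_p`. -/
def wittAlpha (p : ℕ) [Fact p.Prime] (e : ℕ) (i j l : Fin e → ℕ) : ZMod p :=
  MvPolynomial.coeff (xyExp e i j) (∏ m : Fin e, (wittHmod p (m : ℕ)) ^ (l m))

/-- `(K, D)` is a model of `W_e`-DCF:  `K` is a separably closed field of characteristic `p` with
`[K : K^p] = p^e` (where `K^p` is the subfield of `p`-th powers, i.e. the range of the Frobenius)
and `D` is a strict `W_e`-iterative Hasse–Schmidt derivation of dimension `e`.  Multi-indices
`𝐢 ∈ ℕ^e` are represented as functions `Fin e → ℕ`, and the scalars `α_{𝐢,𝐣}(𝐥) ∈ 𝔽_p` act on `K`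
via `ZMod.cast` (the iterated sum of `1`). -/
def IsWeDCF (p e : ℕ) [Fact p.Prime] (K : Type*) [Field K] [CharP K p]
    (D : (Fin e → ℕ) → K → K) : Prop :=
  IsSepClosed K ∧
  Module.finrank ↥(RingHom.fieldRange (frobenius K p)) K = p ^ e ∧
  D 0 = id ∧
  (∀ i : Fin e → ℕ, ∀ x y : K, D i (x + y) = D i x + D i y) ∧
  (∀ i : Fin e → ℕ, ∀ x y : K, D i (x * y) =
     ∑ k ∈ Finset.Iic i, D k x * D (i - k) y) ∧
  (∀ i j : Fin e → ℕ, ∀ x : K,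
     D i (D j x) = ∑ᶠ l : Fin e → ℕ, ZMod.cast (wittAlpha p e i j l) * D l x) ∧
  (∀ x : K, (∀ m : Fin e, D (Pi.single m 1) x = 0) ↔ ∃ y : K, x = y ^ p)

open MvPolynomial

section WittPolynomials

variable (p : ℕ) [Fact p.Prime]

theorem coeff_add_eq_eval₂_wittAdd {R : Type*} [CommRing R] (x y : WittVector p R) (m : ℕ) :
    (x + y).coeff m = eval₂ (Int.castRingHom R) (Function.uncurry ![x.coeff, y.coeff])
      (WittVector.wittAdd p m) := by
  rw [WittVector.add_coeff, WittVector.peval, aeval_def]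
  congr 1

theorem rename_swap_wittAdd (m : ℕ) :
    rename (Prod.map (Equiv.swap (0 : Fin 2) 1) id) (WittVector.wittAdd p m) =
      WittVector.wittAdd p m := by
  let x (k : Fin 2) : WittVector p (MvPolynomial (Fin 2 × ℕ) ℤ) :=
    WittVector.mk p fun n => X (k, n)
  have hC : Int.castRingHom (MvPolynomial (Fin 2 × ℕ) ℤ) = C := RingHom.ext_int _ _
  have h01 : Function.uncurry ![(x 0).coeff, (x 1).coeff] = X := by
    ext1 ⟨k, n⟩
    fin_cases k <;> rfl
  have h10 : Function.uncurry ![(x 1).coeff, (x 0).coeff] =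
      X ∘ Prod.map (Equiv.swap (0 : Fin 2) 1) id := by
    ext1 ⟨k, n⟩
    fin_cases k <;> simp [x, Function.uncurry]
  have h := congrArg (fun w => w.coeff m) (add_comm (x 0) (x 1))
  simp only [coeff_add_eq_eval₂_wittAdd, hC, h01, h10, ← eval₂_rename, eval₂_eta] at h
  exact h.symm

theorem constantCoeff_wittHmod (m : ℕ) : constantCoeff (wittHmod p m) = 0 := by
  rw [wittHmod, constantCoeff_map, WittVector.constantCoeff_wittAdd, map_zero]

theorem vars_wittHmod_subset (m : ℕ) :
    (wittHmod p m).vars ⊆ Finset.univ ×ˢ Finset.range (m + 1) :=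
  (vars_map _ _).trans (WittVector.wittAdd_vars p m)

theorem coeff_add_eq_aeval_wittHmod {R : Type*} [CommRing R] [Algebra (ZMod p) R]
    (x y : WittVector p R) (m : ℕ) :
    (x + y).coeff m = aeval (Function.uncurry ![x.coeff, y.coeff]) (wittHmod p m) := by
  rw [coeff_add_eq_eval₂_wittAdd, wittHmod, aeval_def, eval₂_map]
  congr 1
  exact RingHom.ext_int _ _

end WittPolynomials

section Exponents

variable {e : ℕ} (i j : Fin e → ℕ)

theorem xyExp_zero_apply (m : Fin e) : xyExp e i j (0, (m : ℕ)) = i m := by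
  simp [xyExp, Finsupp.finsetSum_apply, Finsupp.single_apply, Fin.val_inj]

theorem xyExp_one_apply (m : Fin e) : xyExp e i j (1, (m : ℕ)) = j m := by
  simp [xyExp, Finsupp.finsetSum_apply, Finsupp.single_apply, Fin.val_inj]

theorem xyExp_apply_of_le (k : Fin 2) {m : ℕ} (hm : e ≤ m) : xyExp e i j (k, m) = 0 := by
  have (a : Fin e) : (a : ℕ) ≠ m := by omega
  simp [xyExp, Finsupp.finsetSum_apply, this]

theorem degree_xyExp : (xyExp e i j).degree = ∑ m, i m + ∑ m, j m := by
  simp [xyExp, map_sum, Finset.sum_add_distrib]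

theorem mapDomain_swap_xyExp :
    (xyExp e i j).mapDomain (Prod.map (Equiv.swap (0 : Fin 2) 1) id) = xyExp e j i := by
  simp [xyExp, Finsupp.mapDomain_finsetSum, Finsupp.mapDomain_add, Finsupp.mapDomain_single,
    add_comm]

theorem eq_xyExp {v : (Fin 2 × ℕ) →₀ ℕ} (hv : ∀ k m, e ≤ m → v (k, m) = 0) :
    v = xyExp e (fun m => v (0, (m : ℕ))) (fun m => v (1, (m : ℕ))) := by
  ext ⟨k, m⟩
  rcases le_or_gt e m with hm | hm
  · rw [xyExp_apply_of_le _ _ _ hm, hv _ _ hm]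
  · fin_cases k
    · exact (xyExp_zero_apply (fun m : Fin e => v (0, (m : ℕ))) _ ⟨m, hm⟩).symm
    · exact (xyExp_one_apply _ (fun m : Fin e => v (1, (m : ℕ))) ⟨m, hm⟩).symm

theorem prod_pow_xyExp {R : Type*} [CommSemiring R] (f : Fin 2 × ℕ → R) :
    ((xyExp e i j).prod fun a b => f a ^ b) =
      (∏ m : Fin e, f (0, (m : ℕ)) ^ i m) * ∏ m : Fin e, f (1, (m : ℕ)) ^ j m := by
  rw [xyExp, ← Finsupp.prod_finsetSum_index (by simp) (by simp [pow_add]),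
    ← Finset.prod_mul_distrib]
  refine Finset.prod_congr rfl fun m _ => ?_
  rw [Finsupp.prod_add_index' (by simp) (by simp [pow_add])]
  simp

end Exponents

theorem prod_pow_mem_ideal_pow {R ι : Type*} [CommRing R] [Fintype ι] {I : Ideal R} {s : ι → R}
    (hs : ∀ m, s m ∈ I) (l : ι → ℕ) : ∏ m, s m ^ l m ∈ I ^ ∑ m, l m := by
  rw [← Finset.prod_pow_eq_pow_sum]
  exact Ideal.prod_mem_prod fun m _ => Ideal.pow_mem_pow (hs m) _

theorem mem_idealOfVars_of_constantCoeff {σ R : Type*} [CommRing R] {f : MvPolynomial σ R}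
    (hf : constantCoeff f = 0) : f ∈ idealOfVars σ R := by
  rw [← pow_one (idealOfVars σ R), mem_pow_idealOfVars_iff']
  intro v hv
  obtain rfl : v = 0 := v.degree_eq_zero_iff.1 (by omega)
  exact hf

section Alpha

variable (p : ℕ) [Fact p.Prime] {e : ℕ}

theorem wittAlpha_comm (i j l : Fin e → ℕ) : wittAlpha p e i j l = wittAlpha p e j i l := by
  have h : rename (Prod.map (Equiv.swap (0 : Fin 2) 1) id)
      (∏ m : Fin e, wittHmod p (m : ℕ) ^ l m) = ∏ m : Fin e, wittHmod p (m : ℕ) ^ l m := by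
    simp only [map_prod, map_pow, wittHmod, ← map_rename, rename_swap_wittAdd]
  rw [wittAlpha, wittAlpha, ← mapDomain_swap_xyExp i j]
  conv_rhs => rw [← h]
  rw [coeff_rename_mapDomain _ ((Equiv.injective _).prodMap Function.injective_id)]

theorem wittAlpha_eq_zero {i j l : Fin e → ℕ} (h : ∑ m, i m + ∑ m, j m < ∑ m, l m) :
    wittAlpha p e i j l = 0 := by
  refine (mem_pow_idealOfVars_iff' _ _).1 (prod_pow_mem_ideal_pow
    (fun m : Fin e => mem_idealOfVars_of_constantCoeff (constantCoeff_wittHmod p m)) l) _ ?_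
  rwa [degree_xyExp]

theorem le_of_sum_le {l : Fin e → ℕ} {N : ℕ} (h : ∑ m, l m ≤ N) : l ≤ fun _ => N :=
  fun m => (Finset.single_le_sum (fun _ _ => Nat.zero_le _) (Finset.mem_univ m)).trans h

theorem support_wittAlpha_smul_subset {A : Type*} [AddCommGroup A] [Module (ZMod p) A]
    (T : (Fin e → ℕ) → A) {i j : Fin e → ℕ} {M : ℕ} (hM : ∑ m, i m + ∑ m, j m ≤ M) :
    (Function.support fun l => wittAlpha p e i j l • T l) ⊆
      Finset.Iic (fun _ : Fin e => M) := by
  intro l hl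
  rw [Finset.coe_Iic]
  refine le_of_sum_le (le_trans ?_ hM)
  contrapose! hl
  simp [wittAlpha_eq_zero p hl]

theorem finite_support_wittAlpha_smul {A : Type*} [AddCommGroup A] [Module (ZMod p) A]
    (T : (Fin e → ℕ) → A) (i j : Fin e → ℕ) :
    (Function.support fun l => wittAlpha p e i j l • T l).Finite :=
  (Finset.finite_toSet _).subset (support_wittAlpha_smul_subset p T le_rfl)

theorem apply_eq_zero_of_mem_support {l : Fin e → ℕ} {v : (Fin 2 × ℕ) →₀ ℕ}
    (hv : v ∈ (∏ m : Fin e, wittHmod p (m : ℕ) ^ l m).support) (k : Fin 2) {n : ℕ}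
    (hn : e ≤ n) : v (k, n) = 0 := by
  by_contra h
  have hmem : (k, n) ∈ (∏ m : Fin e, wittHmod p (m : ℕ) ^ l m).vars :=
    (mem_vars_iff_mem_support _).2 ⟨v, hv, Finsupp.mem_support_iff.2 h⟩
  obtain ⟨m, -, hm⟩ := Finset.mem_biUnion.1 (vars_prod _ hmem)
  have := vars_wittHmod_subset p m (vars_pow _ _ hm)
  simp at this
  omega

variable {p}

theorem coeff_prod_pow_coeff_add {x y : WittVector p (MvPolynomial (Fin e) (ZMod p))}
    (hx : ∀ m, x.coeff m ∈ idealOfVars (Fin e) (ZMod p))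
    (hy : ∀ m, y.coeff m ∈ idealOfVars (Fin e) (ZMod p))
    (q : Fin e → ℕ) {n : Fin e →₀ ℕ} {N : ℕ} (hN : n.degree ≤ N) :
    coeff n (∏ m : Fin e, (x + y).coeff m ^ q m) =
      ∑ l ∈ Finset.Iic (fun _ : Fin e => N) ×ˢ Finset.Iic (fun _ : Fin e => N),
        wittAlpha p e l.1 l.2 q *
          coeff n ((∏ m : Fin e, x.coeff m ^ l.1 m) * ∏ m : Fin e, y.coeff m ^ l.2 m) := by
  classical
  set P := ∏ m : Fin e, wittHmod p (m : ℕ) ^ q m with hP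
  have h1 : ∏ m : Fin e, (x + y).coeff m ^ q m =
      aeval (Function.uncurry ![x.coeff, y.coeff]) P := by
    simp only [hP, map_prod, map_pow, coeff_add_eq_aeval_wittHmod]
  have hprod (l l' : Fin e → ℕ) :
      ∏ a ∈ (xyExp e l l').support, Function.uncurry ![x.coeff, y.coeff] a ^ xyExp e l l' a =
      (∏ m : Fin e, x.coeff m ^ l m) * ∏ m : Fin e, y.coeff m ^ l' m :=
    prod_pow_xyExp _ _ _
  rw [h1, aeval_def, eval₂_eq, coeff_sum]
  refine Finset.sum_bij_ne_zero
    (fun v _ _ => (fun m : Fin e => v (0, (m : ℕ)), fun m : Fin e => v (1, (m : ℕ)))) ?_ ?_ ?_ ?_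
  · intro v hv hne
    rw [eq_xyExp (e := e) fun k n hn => apply_eq_zero_of_mem_support p hv k hn, algebraMap_eq,
      coeff_C_mul] at hne
    replace hne := right_ne_zero_of_mul hne
    rw [hprod] at hne
    by_contra hmem
    apply hne
    refine (mem_pow_idealOfVars_iff' _ _).1 (?_ : _ ∈ idealOfVars (Fin e) (ZMod p) ^
      ((∑ m : Fin e, v (0, (m : ℕ))) + ∑ m : Fin e, v (1, (m : ℕ)))) n ?_
    · rw [pow_add]
      exact Ideal.mul_mem_mul (prod_pow_mem_ideal_pow (fun m : Fin e => hx m) _)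
        (prod_pow_mem_ideal_pow (fun m : Fin e => hy m) _)
    · by_contra! hle
      refine hmem (Finset.mem_product.2 ⟨Finset.mem_Iic.2 (le_of_sum_le ?_),
        Finset.mem_Iic.2 (le_of_sum_le ?_)⟩) <;> dsimp only <;> omega
  · intro v hv _ w hw _ hvw
    rw [eq_xyExp (e := e) fun k n hn => apply_eq_zero_of_mem_support p hv k hn,
      eq_xyExp (e := e) fun k n hn => apply_eq_zero_of_mem_support p hw k hn,
      (Prod.mk.inj hvw).1, (Prod.mk.inj hvw).2]
  · rintro ⟨l, l'⟩ - hne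
    have hα : coeff (xyExp e l l') P ≠ 0 := left_ne_zero_of_mul hne
    refine ⟨xyExp e l l', mem_support_iff.2 hα, ?_, ?_⟩
    · rwa [algebraMap_eq, coeff_C_mul, hprod]
    · simp only [xyExp_zero_apply, xyExp_one_apply]
  · intro v hv _
    have h := eq_xyExp (e := e) fun k n hn => apply_eq_zero_of_mem_support p hv k hn
    rw [algebraMap_eq, coeff_C_mul, wittAlpha, ← h, ← hprod, ← h]

end Alpha

section GenericElement

variable {p : ℕ} [Fact p.Prime] {e : ℕ} {B : Type*} [CommRing B] [Algebra (ZMod p) B]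

/-- The power series `∑ l, s ^ l • d l` obtained from the generic element `∑ l, X ^ l • d l` by
substituting a tuple `s` of polynomials without constant term. -/
def substGeneric (d : (Fin e → ℕ) → B) (s : Fin e → MvPolynomial (Fin e) (ZMod p)) :
    MvPowerSeries (Fin e) B :=
  fun n => ∑ l ∈ Finset.Iic (fun _ : Fin e => n.degree), coeff n (∏ m, s m ^ l m) • d l

variable {d : (Fin e → ℕ) → B}

theorem coeff_prod_pow_eq_zero {s : Fin e → MvPolynomial (Fin e) (ZMod p)}
    (hs : ∀ m, s m ∈ idealOfVars (Fin e) (ZMod p)) {n : Fin e →₀ ℕ} {l : Fin e → ℕ}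
    (hl : n.degree < ∑ m, l m) : coeff n (∏ m, s m ^ l m) = 0 :=
  (mem_pow_idealOfVars_iff' _ _).1 (prod_pow_mem_ideal_pow hs l) n hl

theorem coeff_substGeneric {s : Fin e → MvPolynomial (Fin e) (ZMod p)}
    (hs : ∀ m, s m ∈ idealOfVars (Fin e) (ZMod p)) {n : Fin e →₀ ℕ} {N : ℕ} (hN : n.degree ≤ N) :
    MvPowerSeries.coeff n (substGeneric d s) =
      ∑ l ∈ Finset.Iic (fun _ : Fin e => N), coeff n (∏ m, s m ^ l m) • d l := by
  refine Finset.sum_subset (Finset.Iic_subset_Iic.2 fun _ => hN) fun l _ hl => ?_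
  rw [coeff_prod_pow_eq_zero hs, zero_smul]
  contrapose! hl
  exact Finset.mem_Iic.2 (le_of_sum_le hl)

theorem substGeneric_zero (h0 : d 0 = 1) :
    substGeneric (p := p) d 0 = 1 := by
  classical
  ext n
  rw [coeff_substGeneric (s := 0) (fun _ => zero_mem _) le_rfl, Finset.sum_eq_single 0]
  · simp [h0, MvPowerSeries.coeff_one, coeff_one, eq_comm]
  · intro l _ hl
    obtain ⟨m, hm⟩ := Function.ne_iff.1 hl
    rw [Finset.prod_eq_zero (Finset.mem_univ m) (zero_pow hm), coeff_zero, zero_smul]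
  · intro h
    exact absurd (Finset.mem_Iic.2 fun _ => Nat.zero_le _) h

theorem coeff_substGeneric_X (n : Fin e →₀ ℕ) :
    MvPowerSeries.coeff n (substGeneric (p := p) d X) = d n := by
  classical
  have hX (l : Fin e → ℕ) : coeff n (∏ m, (X m : MvPolynomial (Fin e) (ZMod p)) ^ l m) =
      if l = n then 1 else 0 := by
    rw [coeff_prod_X_pow]
    refine if_congr ?_ rfl rfl
    constructor
    · rintro rfl
      ext
      simp
    · rintro rfl
      ext
      simp
  rw [coeff_substGeneric (fun m => Ideal.subset_span ⟨m, rfl⟩) le_rfl]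
  simp only [hX, ite_smul, one_smul, zero_smul, Finset.sum_ite_eq']
  refine if_pos (Finset.mem_Iic.2 (le_of_sum_le ?_))
  rw [Finsupp.degree_eq_sum]

theorem sum_wittAlpha_smul
    (hmul : ∀ i j, d i * d j = ∑ᶠ l : Fin e → ℕ, wittAlpha p e i j l • d l)
    {i j : Fin e → ℕ} {M : ℕ} (hM : ∑ m, i m + ∑ m, j m ≤ M) :
    d i * d j = ∑ l ∈ Finset.Iic (fun _ : Fin e => M), wittAlpha p e i j l • d l := by
  rw [hmul]
  exact finsum_eq_sum_of_support_subset _ (support_wittAlpha_smul_subset p d hM)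

theorem substGeneric_mul
    (hmul : ∀ i j, d i * d j = ∑ᶠ l : Fin e → ℕ, wittAlpha p e i j l • d l)
    {x y : WittVector p (MvPolynomial (Fin e) (ZMod p))}
    (hx : ∀ m, x.coeff m ∈ idealOfVars (Fin e) (ZMod p))
    (hy : ∀ m, y.coeff m ∈ idealOfVars (Fin e) (ZMod p))
    (hxy : ∀ m, (x + y).coeff m ∈ idealOfVars (Fin e) (ZMod p)) :
    substGeneric d (fun m => x.coeff m) * substGeneric d (fun m => y.coeff m) =
      substGeneric d (fun m => (x + y).coeff m) := by
  classical
  ext n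
  set N := n.degree with hN
  set M := N + 2 * (e * N) with hM
  have hsum {l : Fin e → ℕ} (hl : l ∈ Finset.Iic (fun _ : Fin e => N)) : ∑ m, l m ≤ e * N := by
    simpa using Finset.sum_le_sum fun m (_ : m ∈ Finset.univ) => Finset.mem_Iic.1 hl m
  rw [coeff_substGeneric (fun m => hxy m) (N := M) (by omega), MvPowerSeries.coeff_mul]
  calc
    _ = ∑ ab ∈ Finset.HasAntidiagonal.antidiagonal n,
        ∑ l ∈ Finset.Iic (fun _ : Fin e => N) ×ˢ Finset.Iic (fun _ : Fin e => N),
        (coeff ab.1 (∏ m : Fin e, x.coeff m ^ l.1 m) *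
          coeff ab.2 (∏ m : Fin e, y.coeff m ^ l.2 m)) • (d l.1 * d l.2) := by
      refine Finset.sum_congr rfl fun ab hab => ?_
      have hdeg : ab.1.degree + ab.2.degree = N := by
        rw [hN, ← Finset.HasAntidiagonal.mem_antidiagonal.1 hab, map_add]
      rw [coeff_substGeneric (fun m => hx m) (N := N) (by omega),
        coeff_substGeneric (fun m => hy m) (N := N) (by omega), Finset.sum_mul_sum,
        Finset.sum_product]
      simp only [smul_mul_smul_comm]
    _ = ∑ l ∈ Finset.Iic (fun _ : Fin e => N) ×ˢ Finset.Iic (fun _ : Fin e => N),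
        coeff n ((∏ m : Fin e, x.coeff m ^ l.1 m) * ∏ m : Fin e, y.coeff m ^ l.2 m) •
          (d l.1 * d l.2) := by
      rw [Finset.sum_comm]
      simp only [coeff_mul, Finset.sum_smul]
    _ = ∑ l ∈ Finset.Iic (fun _ : Fin e => N) ×ˢ Finset.Iic (fun _ : Fin e => N),
        ∑ q ∈ Finset.Iic (fun _ : Fin e => M), (wittAlpha p e l.1 l.2 q *
          coeff n ((∏ m : Fin e, x.coeff m ^ l.1 m) * ∏ m : Fin e, y.coeff m ^ l.2 m)) • d q := by
      refine Finset.sum_congr rfl fun l hl => ?_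
      obtain ⟨hl1, hl2⟩ := Finset.mem_product.1 hl
      have h1 := hsum hl1
      have h2 := hsum hl2
      rw [sum_wittAlpha_smul hmul (M := M) (by omega), Finset.smul_sum]
      simp only [smul_smul, mul_comm]
    _ = _ := by
      rw [Finset.sum_comm]
      simp only [coeff_prod_pow_coeff_add hx hy _ hN.ge, Finset.sum_smul]

theorem coeff_mem_idealOfVars {x : WittVector p (MvPolynomial (Fin e) (ZMod p))}
    (hx : WittVector.map constantCoeff x = 0) (m : ℕ) :
    x.coeff m ∈ idealOfVars (Fin e) (ZMod p) := by
  apply mem_idealOfVars_of_constantCoeff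
  rw [← WittVector.map_coeff, hx, WittVector.zero_coeff]

theorem substGeneric_pow (h0 : d 0 = 1)
    (hmul : ∀ i j, d i * d j = ∑ᶠ l : Fin e → ℕ, wittAlpha p e i j l • d l)
    {x : WittVector p (MvPolynomial (Fin e) (ZMod p))}
    (hx : WittVector.map constantCoeff x = 0) (k : ℕ) :
    substGeneric d (fun m => x.coeff m) ^ k = substGeneric d (fun m => (x * k).coeff m) := by
  induction k with
  | zero =>
    rw [pow_zero, ← substGeneric_zero (p := p) h0]
    congr 1
    ext1 m
    simp
  | succ k ih =>
    have hk : WittVector.map constantCoeff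
        (x * (k : WittVector p (MvPolynomial (Fin e) (ZMod p)))) = 0 := by rw [map_mul, hx, zero_mul]
    have hadd : WittVector.map constantCoeff
        (x * (k : WittVector p (MvPolynomial (Fin e) (ZMod p))) + x) = 0 := by rw [map_add, hk, hx, add_zero]
    rw [pow_succ, ih, substGeneric_mul hmul (coeff_mem_idealOfVars hk) (coeff_mem_idealOfVars hx)
      (coeff_mem_idealOfVars hadd), Nat.cast_succ, mul_add, mul_one]

/-- The generic element `∑ l, X ^ l • d l` of an algebra with the multiplication rule of `W_e` is
killed by `p ^ e`, since `W_e` is. -/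
theorem substGeneric_X_pow_card (h0 : d 0 = 1)
    (hmul : ∀ i j, d i * d j = ∑ᶠ l : Fin e → ℕ, wittAlpha p e i j l • d l) :
    substGeneric (p := p) d X ^ p ^ e = 1 := by
  let x : WittVector p (MvPolynomial (Fin e) (ZMod p)) :=
    WittVector.mk p fun m => if h : m < e then X ⟨m, h⟩ else 0
  have hx : WittVector.map constantCoeff x = 0 := by
    ext m
    by_cases h : m < e <;> simp [x, WittVector.map_coeff, h]
  have hX : (fun m : Fin e => x.coeff m) = X := by
    ext1 m
    simp [x]
  rw [← hX, substGeneric_pow h0 hmul hx, ← substGeneric_zero (p := p) h0]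
  congr 1
  ext1 m
  rw [Nat.cast_pow, WittVector.mul_pow_charP_coeff_zero _ m.2, Pi.zero_apply]

theorem pow_card_eq_zero_of_commRing [Nontrivial B] (h0 : d 0 = 1)
    (hmul : ∀ i j, d i * d j = ∑ᶠ l : Fin e → ℕ, wittAlpha p e i j l • d l)
    {i : Fin e → ℕ} (hi : i ≠ 0) : d i ^ p ^ e = 0 := by
  classical
  have : CharP B p := charP_of_injective_algebraMap (algebraMap (ZMod p) B).injective p
  have : ExpChar B p := ExpChar.prime Fact.out
  have hp : p ≠ 0 := (Fact.out : p.Prime).ne_zero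
  let n : Fin e →₀ ℕ := Finsupp.equivFunOnFinite.symm i
  have hn : n ≠ 0 := fun h => hi (congrArg DFunLike.coe h)
  have h := substGeneric_X_pow_card h0 hmul
  rw [← MvPowerSeries.map_iterateFrobenius_expand p hp] at h
  replace h := congrArg (MvPowerSeries.coeff (p ^ e • n)) h
  rw [MvPowerSeries.coeff_map, MvPowerSeries.coeff_expand_smul, coeff_substGeneric_X,
    iterateFrobenius_def, MvPowerSeries.coeff_one, if_neg] at h
  · exact h
  · simp [hp, hn]

end GenericElement

open scoped IsMulCommutative in
theorem pow_card_eq_zero_of_wittAlpha {p : ℕ} [Fact p.Prime] {e : ℕ} {A : Type*} [Ring A]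
    [Nontrivial A] [Algebra (ZMod p) A] {T : (Fin e → ℕ) → A} (h0 : T 0 = 1)
    (hmul : ∀ i j, T i * T j = ∑ᶠ l : Fin e → ℕ, wittAlpha p e i j l • T l)
    {i : Fin e → ℕ} (hi : i ≠ 0) : T i ^ p ^ e = 0 := by
  have hcomm (i j : Fin e → ℕ) : T i * T j = T j * T i := by
    simp only [hmul, wittAlpha_comm p i j]
  have : IsMulCommutative (Algebra.adjoin (ZMod p) (Set.range T)) :=
    Algebra.isMulCommutative_adjoin _ (by rintro _ ⟨i, rfl⟩ _ ⟨j, rfl⟩; exact hcomm i j)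
  let d (i : Fin e → ℕ) : Algebra.adjoin (ZMod p) (Set.range T) :=
    ⟨T i, Algebra.subset_adjoin ⟨i, rfl⟩⟩
  have hdmul (i j : Fin e → ℕ) : d i * d j = ∑ᶠ l, wittAlpha p e i j l • d l :=
    Subtype.ext <| (hmul i j).trans <| Eq.symm <|
      (Algebra.adjoin (ZMod p) (Set.range T)).val.toAddMonoidHom.map_finsum
        (finite_support_wittAlpha_smul p d i j)
  exact congrArg Subtype.val (pow_card_eq_zero_of_commRing (d := d) (Subtype.ext h0) hdmul hi)

/-- In a model of `W_e`-DCF, for every multi-index `𝐢 ≠ 0` the `p^e`-fold composition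
`D_𝐢^(p^e)` is the zero map. -/
theorem WeDCF_iterate_pow_card_eq_zero (p e : ℕ) [Fact p.Prime]
    (K : Type*) [Field K] [CharP K p] (D : (Fin e → ℕ) → K → K)
    (hD : IsWeDCF p e K D) (i : Fin e → ℕ) (hi : i ≠ 0) :
    ∀ x : K, (D i)^[p ^ e] x = 0 := by
  obtain ⟨-, -, h0, hadd, -, hiter, -⟩ := hD
  let _ : Algebra (ZMod p) K := ZMod.algebra K p
  let T (i : Fin e → ℕ) : Module.End (ZMod p) K :=
    (AddMonoidHom.mk' (D i) (hadd i)).toZModLinearMap p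
  have hT0 : T 0 = 1 := LinearMap.ext fun x => congrFun h0 x
  have hTmul (i j : Fin e → ℕ) : T i * T j = ∑ᶠ l, wittAlpha p e i j l • T l := by
    ext x
    have hx := (LinearMap.applyₗ (R := ZMod p) (M₂ := K) x).toAddMonoidHom.map_finsum
      (finite_support_wittAlpha_smul p T i j)
    refine (hiter i j x).trans (Eq.trans (finsum_congr fun l => ?_) hx.symm)
    exact (Algebra.smul_def (wittAlpha p e i j l) (D l x)).symm
  intro x
  have h := LinearMap.congr_fun (pow_card_eq_zero_of_wittAlpha hT0 hTmul hi) x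
  rwa [Module.End.pow_apply] at h
end
end

section
/- Let (K, D) be a model of W_e-DCF and for 1 ≤ m ≤ e and n ∈ ℕ set ∂_{m,n} := D_{n·𝐞_m}. Then for every n ≥ 1: ∂_{e,n}^(p) = 0, and ∂_{m,n}^(p) = ∂_{m+1,n} for every m < e. -/
noncomputable section

open scoped BigOperators

/-! ### Coefficients of cyclically symmetric polynomials -/

/-- If `f` generates a cyclic action of `p`-power order, an invariant function sums modulo `p`
to its sum over the fixed points. -/
theorem sum_eq_sum_fixedPoints_of_pow_eq_one (p : ℕ) [Fact p.Prime] {α : Type*} [Fintype α]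
    [DecidableEq α] (f : α → α) (hf : f^[p] = id) (g : α → ZMod p) (hg : ∀ a, g (f a) = g a) :
    ∑ a, g a = ∑ a with f a = a, g a := by
  have key (c : ZMod p) : (∑ a with g a = c, g a) = ∑ a with f a = a ∧ g a = c, g a := by
    have hconst (s : Finset α) (hs : ∀ a ∈ s, g a = c) : ∑ a ∈ s, g a = (s.card : ZMod p) * c := by
      rw [Finset.sum_congr rfl hs]; simp
    rw [hconst _ (by simp), hconst _ (by simp +contextual)]
    congr 1
    let f' : Function.End {a // g a = c} := fun a => ⟨f a, (hg a).trans a.2⟩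
    have hval (k : ℕ) (a : {a // g a = c}) : ((f' ^ k) a : α) = f^[k] a := by
      induction k generalizing a with
      | zero => rfl
      | succ k ih =>
        rw [pow_succ]
        exact ih (f' a)
    have hf' : f' ^ p ^ 1 = 1 := by
      funext a
      apply Subtype.ext
      rw [pow_one, hval, hf]
      rfl
    have h := Equiv.Perm.card_fixedPoints_modEq (p := p) hf'
    rw [← ZMod.natCast_eq_natCast_iff] at h
    rw [Fintype.card_subtype] at h
    rw [h]
    congr 1
    rw [← Fintype.card_subtype]
    refine Fintype.card_congr ⟨fun a => ⟨a.1.1, congrArg Subtype.val a.2, a.1.2⟩,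
      fun a => ⟨⟨a.1, a.2.2⟩, Subtype.ext a.2.1⟩, fun _ => rfl, fun _ => rfl⟩
  rw [← Finset.sum_fiberwise (s := Finset.univ) (g := g),
    ← Finset.sum_fiberwise (s := Finset.univ.filter (fun a => f a = a)) (g := g)]
  refine Finset.sum_congr rfl fun c _ => ?_
  rw [key c, Finset.filter_filter]

/-- For a cyclically symmetric polynomial in `p` variables over `𝔽_p`, the coefficient of
`(x_1 ⋯ x_p) ^ n` can be read off after identifying all the variables. -/
theorem coeff_const_eq_coeff_aeval_X (p : ℕ) [Fact p.Prime] (f : MvPolynomial (ZMod p) (ZMod p))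
    (hf : MvPolynomial.rename (Equiv.addRight (1 : ZMod p)) f = f) (n : ℕ) :
    MvPolynomial.coeff (Finsupp.equivFunOnFinite.symm fun _ => n) f =
      (MvPolynomial.aeval (fun _ => (Polynomial.X : Polynomial (ZMod p))) f).coeff (p * n) := by
  classical
  set E : Equiv.Perm (ZMod p) := Equiv.addRight (1 : ZMod p) with hE
  have hcoeff (s : ZMod p →₀ ℕ) : f.coeff (s.mapDomain E) = f.coeff s := by
    conv_lhs => rw [← hf]
    exact MvPolynomial.coeff_rename_mapDomain _ E.injective _ _
  have hEk (k : ℕ) (a : ZMod p) : E^[k] a = a + k := by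
    induction k with
    | zero => simp
    | succ k ih => rw [Function.iterate_succ_apply', ih]; simp [hE, add_assoc]
  let T : Finset (ZMod p →₀ ℕ) := f.support.filter fun s => s.degree = p * n
  have hT (s) (hs : s ∈ T) : s.mapDomain E ∈ T := by
    simp only [T, Finset.mem_filter, MvPolynomial.mem_support_iff, hcoeff] at hs ⊢
    exact ⟨hs.1, by rw [← hs.2]; exact Finsupp.degree_mapDomain _ _⟩
  have hR : (MvPolynomial.aeval (fun _ => (Polynomial.X : Polynomial (ZMod p))) f).coeff (p * n)
      = ∑ s ∈ T, f.coeff s := by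
    conv_lhs => rw [← MvPolynomial.support_sum_monomial_coeff f]
    rw [map_sum, Polynomial.finsetSum_coeff, Finset.sum_filter]
    refine Finset.sum_congr rfl fun s _ => ?_
    rw [MvPolynomial.aeval_monomial, Finsupp.prod, Finset.prod_pow_eq_pow_sum,
      Polynomial.algebraMap_eq, Polynomial.coeff_C_mul_X_pow, ← Finsupp.degree_apply]
    simp [eq_comm]
  let F : T → T := fun s => ⟨s.1.mapDomain E, hT s.1 s.2⟩
  have hFk (k : ℕ) (s : T) : ((F^[k] s : T) : ZMod p →₀ ℕ) = s.1.mapDomain (E^[k]) := by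
    induction k with
    | zero => simp
    | succ k ih =>
      rw [Function.iterate_succ_apply', Function.iterate_succ', Finsupp.mapDomain_comp, ← ih]
  have hF : F^[p] = id := by
    funext s
    apply Subtype.ext
    rw [hFk, show E^[p] = id by funext a; rw [hEk]; simp]
    simp
  rw [hR, ← Finset.sum_coe_sort T,
    sum_eq_sum_fixedPoints_of_pow_eq_one p F hF (fun s => f.coeff s.1) (fun s => hcoeff s.1)]
  set c : ZMod p →₀ ℕ := Finsupp.equivFunOnFinite.symm fun _ => n with hc
  have hfix (s : T) : F s = s ↔ s.1 = c := by
    constructor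
    · intro h
      have h1 : s.1.mapDomain E = s.1 := congrArg Subtype.val h
      have h2 (a : ZMod p) : s.1 (a + 1) = s.1 a := by
        conv_lhs => rw [← h1]
        exact Finsupp.mapDomain_apply E.injective s.1 a
      have h3 (k : ℕ) : s.1 (k : ZMod p) = s.1 0 := by
        induction k with
        | zero => simp
        | succ k ih => rw [Nat.cast_succ, h2, ih]
      have h4 (a : ZMod p) : s.1 a = s.1 0 := by
        rw [← h3 a.val, ZMod.natCast_zmod_val]
      have h5 : s.1.degree = p * n := (Finset.mem_filter.1 s.2).2
      rw [Finsupp.degree_eq_sum, Finset.sum_congr rfl fun a _ => h4 a] at h5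
      simp only [Finset.sum_const, Finset.card_univ, ZMod.card, smul_eq_mul] at h5
      have h6 := Nat.eq_of_mul_eq_mul_left (Fact.out : p.Prime).pos h5
      ext a
      rw [h4, h6]
      rfl
    · intro h
      apply Subtype.ext
      change s.1.mapDomain E = s.1
      rw [h]
      ext a
      obtain ⟨b, rfl⟩ := E.surjective a
      rw [Finsupp.mapDomain_apply E.injective]
      rfl
  simp only [hfix]
  by_cases hcf : f.coeff c = 0
  · rw [hcf, Finset.sum_eq_zero]
    intro s hs
    rw [(Finset.mem_filter.1 hs).2, hcf]
  · have hcT : c ∈ T := by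
      refine Finset.mem_filter.2 ⟨MvPolynomial.mem_support_iff.2 hcf, ?_⟩
      rw [Finsupp.degree_eq_sum]
      simp [hc, ZMod.card]
    rw [Finset.sum_eq_single ⟨c, hcT⟩]
    · intro s hs hne
      exact absurd (Subtype.ext (Finset.mem_filter.1 hs).2) hne
    · simp

/-! ### The coefficients `wittAlpha` -/

theorem wittVector_add_coeff_eq_aeval (p : ℕ) [Fact p.Prime] {B : Type*} [CommRing B]
    [Algebra (ZMod p) B] (x y : WittVector p B) (m : ℕ) :
    (x + y).coeff m =
      MvPolynomial.aeval (fun q : Fin 2 × ℕ => ![x.coeff, y.coeff] q.1 q.2) (wittHmod p m) := by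
  rw [WittVector.add_coeff, WittVector.peval, wittHmod]
  exact (MvPolynomial.aeval_map_algebraMap (ZMod p) _ _).symm

theorem vars_prod_wittHmod_subset (p : ℕ) [Fact p.Prime] (e : ℕ) (l : Fin e → ℕ)
    {q : Fin 2 × ℕ} (hq : q ∈ (∏ m : Fin e, (wittHmod p (m : ℕ)) ^ (l m)).vars) : q.2 < e := by
  classical
  obtain ⟨m, -, hm⟩ := Finset.mem_biUnion.1 (MvPolynomial.vars_prod _ hq)
  have h := WittVector.wittAdd_vars p m
    (MvPolynomial.vars_map _ (f := Int.castRingHom (ZMod p)) (MvPolynomial.vars_pow _ _ hm))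
  have := Finset.mem_range.1 (Finset.mem_product.1 h).2
  omega

theorem xyExp_apply (e : ℕ) (i j : Fin e → ℕ) (a : Fin 2) (m : Fin e) :
    xyExp e i j (a, m) = ![i, j] a m := by
  rw [xyExp, Finsupp.finsetSum_apply, Finset.sum_eq_single m]
  · fin_cases a <;> simp
  · intro b _ hb
    have : (b : ℕ) ≠ m := fun h => hb (Fin.ext h)
    simp [this]
  · simp

theorem xyExp_inj {e : ℕ} {i j i' j' : Fin e → ℕ} :
    xyExp e i j = xyExp e i' j' ↔ i = i' ∧ j = j' := by
  refine ⟨fun h => ⟨funext fun m => ?_, funext fun m => ?_⟩, fun h => by rw [h.1, h.2]⟩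
  · simpa [xyExp_apply] using DFunLike.congr_fun h ((0 : Fin 2), (m : ℕ))
  · simpa [xyExp_apply] using DFunLike.congr_fun h ((1 : Fin 2), (m : ℕ))

theorem exists_eq_xyExp (e : ℕ) (s : Fin 2 × ℕ →₀ ℕ) (hs : ∀ q ∈ s.support, q.2 < e) :
    ∃ i j, s = xyExp e i j := by
  refine ⟨fun m => s (0, m), fun m => s (1, m), ?_⟩
  ext ⟨a, m⟩
  by_cases hm : m < e
  · rw [show m = ((⟨m, hm⟩ : Fin e) : ℕ) from rfl, xyExp_apply]
    fin_cases a <;> simp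
  · rw [Finsupp.notMem_support_iff.1 fun h => hm (hs _ h), xyExp, Finsupp.finsetSum_apply,
      Finset.sum_eq_zero]
    intro b _
    have : (b : ℕ) ≠ m := by omega
    simp [this]

theorem xyExp_prod_pow (e : ℕ) (i j : Fin e → ℕ) {B : Type*} [CommRing B]
    (φ : Fin 2 × ℕ → B) :
    (xyExp e i j).prod (fun q k => φ q ^ k) =
      (∏ m : Fin e, φ (0, m) ^ i m) * ∏ m : Fin e, φ (1, m) ^ j m := by
  rw [xyExp, ← Finsupp.prod_finsetSum_index (by simp) (by simp [pow_add]),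
    ← Finset.prod_mul_distrib]
  refine Finset.prod_congr rfl fun m _ => ?_
  rw [Finsupp.prod_add_index' (by simp) (by simp [pow_add]), Finsupp.prod_single_index (by simp),
    Finsupp.prod_single_index (by simp)]

theorem finite_support_wittAlpha (p : ℕ) [Fact p.Prime] (e : ℕ) (i j : Fin e → ℕ) :
    (Function.support (wittAlpha p e i j)).Finite := by
  refine Set.Finite.subset
    (Set.finite_Iic (fun _ : Fin e => (xyExp e i j).degree)) fun l hl => ?_
  have hmem (m : ℕ) : wittHmod p m ∈ MvPolynomial.idealOfVars (Fin 2 × ℕ) (ZMod p) := by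
    have := (MvPolynomial.mem_pow_idealOfVars_iff 1 (wittHmod p m)).2 fun s hs => by
      rw [Nat.one_le_iff_ne_zero, Ne, Finsupp.degree_eq_zero_iff]
      rintro rfl
      refine MvPolynomial.mem_support_iff.1 hs ?_
      rw [← MvPolynomial.constantCoeff_eq, wittHmod, MvPolynomial.constantCoeff_map,
        WittVector.constantCoeff_wittAdd, map_zero]
    rwa [pow_one] at this
  have hprod : ∏ m : Fin e, (wittHmod p (m : ℕ)) ^ (l m) ∈
      MvPolynomial.idealOfVars (Fin 2 × ℕ) (ZMod p) ^ (∑ m, l m) := by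
    rw [← Finset.prod_pow_eq_pow_sum]
    exact Ideal.prod_mem_prod fun m _ => Ideal.pow_mem_pow (hmem m) _
  have hdeg := (MvPolynomial.mem_pow_idealOfVars_iff _ _).1 hprod _
    (MvPolynomial.mem_support_iff.2 hl)
  exact fun m => (Finset.single_le_sum (fun _ _ => Nat.zero_le _) (Finset.mem_univ m)).trans hdeg

/-! ### Sums of Witt vectors concentrated in one coordinate -/

/-- The Witt vector whose only possibly nonzero coordinate is `x`, in position `r`. -/
def wittSingle (p r : ℕ) {B : Type*} [CommRing B] (x : B) : WittVector p B :=
  WittVector.mk p fun m => if m = r then x else 0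

theorem map_wittSingle (p r : ℕ) [Fact p.Prime] {B C : Type*} [CommRing B] [CommRing C]
    (f : B →+* C) (x : B) :
    WittVector.map f (wittSingle p r x) = wittSingle p r (f x) := by
  ext m
  simp [wittSingle, WittVector.map_coeff, apply_ite f]

/-- The sum of generic Witt vectors concentrated in position `r`, one for each index in `S`. -/
def wittSumSingle (p r : ℕ) [Fact p.Prime] {ι : Type*} (S : Finset ι) :
    WittVector p (MvPolynomial ι (ZMod p)) :=
  ∑ t ∈ S, wittSingle p r (MvPolynomial.X t)

theorem vars_wittSumSingle_coeff_subset (p r : ℕ) [Fact p.Prime] {ι : Type*} (S : Finset ι)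
    (m : ℕ) : ↑((wittSumSingle p r S).coeff m).vars ⊆ (S : Set ι) := by
  rw [← MvPolynomial.mem_supported (R := ZMod p)]
  let A := MvPolynomial.supported (ZMod p) (S : Set ι)
  let w : WittVector p A := ∑ t : S, wittSingle p r
    ⟨MvPolynomial.X t.1, MvPolynomial.X_mem_supported.2 t.2⟩
  have hw : WittVector.map A.val.toRingHom w = wittSumSingle p r S := by
    rw [map_sum, wittSumSingle, ← Finset.sum_coe_sort S]
    exact Finset.sum_congr rfl fun t _ => map_wittSingle ..
  rw [← hw, WittVector.map_coeff]
  exact (w.coeff m).2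

/-- The image of the monomial with exponent `l` under evaluation at the first `e` coordinates of
`wittSumSingle p r S`. -/
def wittSumMonomial (p r e : ℕ) [Fact p.Prime] {ι : Type*} (S : Finset ι) (l : Fin e → ℕ) :
    MvPolynomial ι (ZMod p) :=
  ∏ m : Fin e, (wittSumSingle p r S).coeff m ^ l m

theorem vars_wittSumMonomial_subset (p r e : ℕ) [Fact p.Prime] {ι : Type*} (S : Finset ι)
    (l : Fin e → ℕ) : ↑(wittSumMonomial p r e S l).vars ⊆ (S : Set ι) := by
  rw [← MvPolynomial.mem_supported (R := ZMod p)]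
  exact Subalgebra.prod_mem _ fun m _ => Subalgebra.pow_mem _
    (MvPolynomial.mem_supported.2 (vars_wittSumSingle_coeff_subset p r S m)) _

theorem rename_wittSumMonomial_univ (p r e : ℕ) [Fact p.Prime] {ι : Type*} [Fintype ι]
    (σ : Equiv.Perm ι) (l : Fin e → ℕ) :
    MvPolynomial.rename σ (wittSumMonomial p r e Finset.univ l) =
      wittSumMonomial p r e Finset.univ l := by
  have h : WittVector.map (MvPolynomial.rename (R := ZMod p) σ).toRingHom
      (wittSumSingle p r Finset.univ) = wittSumSingle p r Finset.univ := by
    rw [wittSumSingle, map_sum]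
    refine (Finset.sum_congr rfl fun t _ => ?_).trans
      (Equiv.sum_comp σ fun t => wittSingle p r (MvPolynomial.X (R := ZMod p) t))
    rw [map_wittSingle]
    congr 1
    exact MvPolynomial.rename_X (R := ZMod p) _ _
  rw [wittSumMonomial, map_prod]
  refine Finset.prod_congr rfl fun m _ => ?_
  rw [map_pow]
  congr 1
  conv_rhs => rw [← h]
  rw [WittVector.map_coeff]
  rfl

theorem aeval_X_wittSumMonomial_univ (p r e : ℕ) [Fact p.Prime] (l : Fin e → ℕ) :
    MvPolynomial.aeval (fun _ => (Polynomial.X : Polynomial (ZMod p)))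
      (wittSumMonomial p r e (Finset.univ : Finset (ZMod p)) l) =
      ∏ m : Fin e, (if (m : ℕ) = r + 1 then Polynomial.X ^ p else 0) ^ l m := by
  set f : MvPolynomial (ZMod p) (ZMod p) →ₐ[ZMod p] Polynomial (ZMod p) :=
    MvPolynomial.aeval (fun _ => (Polynomial.X : Polynomial (ZMod p))) with hf
  have h : WittVector.map f.toRingHom (wittSumSingle p r (Finset.univ : Finset (ZMod p))) =
      wittSingle p r (Polynomial.X : Polynomial (ZMod p)) * (p : WittVector p (Polynomial (ZMod p))) := by
    rw [wittSumSingle, map_sum, Finset.sum_congr rfl fun t _ => map_wittSingle p r _ _,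
      Finset.sum_congr rfl fun t _ => congrArg (wittSingle p r)
        (show f.toRingHom (MvPolynomial.X t) = Polynomial.X from MvPolynomial.aeval_X _ _)]
    simp [ZMod.card, mul_comm]
  rw [wittSumMonomial, map_prod]
  refine Finset.prod_congr rfl fun m _ => ?_
  rw [map_pow]
  congr 1
  have hm : f ((wittSumSingle p r (Finset.univ : Finset (ZMod p))).coeff m) =
      (wittSingle p r (Polynomial.X : Polynomial (ZMod p)) *
        (p : WittVector p (Polynomial (ZMod p)))).coeff m := by
    rw [← h, WittVector.map_coeff]; rfl
  rw [hm]
  rcases hk : (m : ℕ) with _ | k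
  · rw [WittVector.mul_charP_coeff_zero]; simp
  · rw [WittVector.mul_charP_coeff_succ]
    simp [wittSingle, ite_pow, (Fact.out : p.Prime).ne_zero]

/-- If `t` does not occur in `f`, the coefficients of `X t ^ k * f` are those of `f`, shifted. -/
theorem coeff_X_pow_mul_of_notMem_vars {ι R : Type*} [CommRing R] (t : ι)
    (f : MvPolynomial ι R) (hf : t ∉ f.vars) (s : ι →₀ ℕ) (hs : s t = 0) (k n : ℕ) :
    MvPolynomial.coeff (Finsupp.single t n + s) (MvPolynomial.X t ^ k * f) =
      if k = n then MvPolynomial.coeff s f else 0 := by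
  classical
  rw [MvPolynomial.X_pow_eq_monomial, MvPolynomial.coeff_monomial_mul', one_mul]
  split_ifs with h1 h2 h2
  · rw [h2, add_tsub_cancel_left]
  · by_contra h3
    refine hf ((MvPolynomial.mem_vars_iff_mem_support t).2
      ⟨_, MvPolynomial.mem_support_iff.2 h3, ?_⟩)
    have h4 := h1 t
    simp only [Finsupp.single_eq_same, Finsupp.add_apply, hs] at h4
    simp only [Finsupp.mem_support_iff, Finsupp.tsub_apply, Finsupp.add_apply,
      Finsupp.single_eq_same, hs]
    omega
  · exact absurd (h2 ▸ le_self_add) h1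
  · rfl

theorem coeff_wittSumMonomial_insert (p e n : ℕ) [Fact p.Prime] {ι : Type*} [DecidableEq ι]
    (r : Fin e) (S : Finset ι) (t : ι) (ht : t ∉ S) (s : ι →₀ ℕ) (hs : s t = 0)
    (C : (Fin e → ℕ) →₀ ZMod p)
    (hC : ∀ l, C l = (wittSumMonomial p r e S l).coeff s) (l' : Fin e → ℕ) :
    (wittSumMonomial p r e (insert t S) l').coeff (Finsupp.single t n + s) =
      C.sum fun l a => a * wittAlpha p e (Pi.single r n) l l' := by
  classical
  set x : WittVector p (MvPolynomial ι (ZMod p)) := wittSingle p r (MvPolynomial.X t) with hx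
  set w := wittSumSingle p r S with hw
  let φ : Fin 2 × ℕ → MvPolynomial ι (ZMod p) := fun q => ![x.coeff, w.coeff] q.1 q.2
  have heval : wittSumMonomial p r e (insert t S) l' =
      MvPolynomial.aeval φ (∏ m : Fin e, (wittHmod p (m : ℕ)) ^ (l' m)) := by
    rw [wittSumMonomial, map_prod]
    refine Finset.prod_congr rfl fun m _ => ?_
    rw [map_pow, wittSumSingle, Finset.sum_insert ht]
    congr 1
    exact wittVector_add_coeff_eq_aeval p x w m
  have hmon (i l : Fin e → ℕ) :
      ((xyExp e i l).prod fun q k => φ q ^ k).coeff (Finsupp.single t n + s) =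
        if i = Pi.single r n then C l else 0 := by
    rw [xyExp_prod_pow]
    change MvPolynomial.coeff _
      ((∏ m : Fin e, x.coeff m ^ i m) * wittSumMonomial p r e S l) = _
    have hvar : t ∉ (wittSumMonomial p r e S l).vars := fun h =>
      ht (vars_wittSumMonomial_subset p r e S l h)
    by_cases hi : ∀ m, m ≠ r → i m = 0
    · have hprod : ∏ m : Fin e, x.coeff m ^ i m = MvPolynomial.X t ^ i r := by
        rw [Finset.prod_eq_single r]
        · simp [hx, wittSingle]
        · intro m _ hm
          rw [hi m hm, pow_zero]
        · simp
      rw [hprod, coeff_X_pow_mul_of_notMem_vars t _ hvar s hs, ← hC]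
      congr 1
      refine propext ⟨fun h => funext fun m => ?_, fun h => by simp [h]⟩
      by_cases hm : m = r
      · subst hm; simp [h]
      · simp [hi m hm, hm]
    · push Not at hi
      obtain ⟨m, hm, him⟩ := hi
      rw [Finset.prod_eq_zero (Finset.mem_univ m), zero_mul, MvPolynomial.coeff_zero, if_neg]
      · rintro rfl
        simp [hm] at him
      · have : (m : ℕ) ≠ r := fun h => hm (Fin.ext h)
        simp [hx, wittSingle, this, him]
  have hlin (P : MvPolynomial (Fin 2 × ℕ) (ZMod p)) (hP : ∀ q ∈ P.vars, q.2 < e) :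
      (MvPolynomial.aeval φ P).coeff (Finsupp.single t n + s) =
        C.sum fun l a => a * P.coeff (xyExp e (Pi.single r n) l) := by
    conv_lhs => rw [← MvPolynomial.support_sum_monomial_coeff P]
    have hterm (u) (hu : u ∈ P.support) :
        (MvPolynomial.aeval φ (MvPolynomial.monomial u (P.coeff u))).coeff
          (Finsupp.single t n + s) =
        ∑ l ∈ C.support, if u = xyExp e (Pi.single r n) l then C l * P.coeff u else 0 := by
      obtain ⟨i, j, rfl⟩ := exists_eq_xyExp e u fun q hq =>
        hP q ((MvPolynomial.mem_vars_iff_mem_support q).2 ⟨u, hu, hq⟩)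
      rw [MvPolynomial.aeval_monomial, MvPolynomial.algebraMap_eq, MvPolynomial.coeff_C_mul, hmon]
      simp only [xyExp_inj]
      by_cases hi : i = Pi.single r n
      · simp only [hi, true_and, if_true, Finset.sum_ite_eq, Finsupp.mem_support_iff]
        split_ifs with h
        · ring
        · rw [not_not.1 h, mul_zero]
      · simp [hi]
    rw [map_sum, MvPolynomial.coeff_sum, Finset.sum_congr rfl hterm, Finset.sum_comm, Finsupp.sum]
    refine Finset.sum_congr rfl fun l _ => ?_
    rw [Finset.sum_ite_eq']
    split_ifs with h
    · rfl
    · rw [MvPolynomial.notMem_support_iff.1 h, mul_zero]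
  rw [heval, hlin _ fun q hq => vars_prod_wittHmod_subset p e l' hq]
  rfl

/-! ### Iterating the operators -/

theorem exists_iterate_eq_linearCombination (p e : ℕ) [Fact p.Prime] {K : Type*} [Field K]
    [CharP K p] [Algebra (ZMod p) K] (D : (Fin e → ℕ) → K → K)
    (hadd : ∀ i x y, D i (x + y) = D i x + D i y) (h0 : D 0 = id)
    (hcomp : ∀ i j x, D i (D j x) = ∑ᶠ l, ZMod.cast (wittAlpha p e i j l) * D l x)
    {ι : Type*} [DecidableEq ι] (r : Fin e) (n : ℕ) (S : Finset ι) :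
    ∃ C : (Fin e → ℕ) →₀ ZMod p,
      (∀ x, (D (Pi.single r n))^[S.card] x =
        Finsupp.linearCombination (ZMod p) (fun l => D l x) C) ∧
      ∀ l, C l = (wittSumMonomial p r e S l).coeff (∑ t ∈ S, Finsupp.single t n) := by
  have hcast (a : ZMod p) (y : K) : (ZMod.cast a : K) * y = a • y := by
    rw [Algebra.smul_def]
    congr 1
    exact RingHom.congr_fun (Subsingleton.elim (ZMod.castHom dvd_rfl K) (algebraMap (ZMod p) K)) a
  let α (i j : Fin e → ℕ) : (Fin e → ℕ) →₀ ZMod p :=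
    Finsupp.ofSupportFinite (wittAlpha p e i j) (finite_support_wittAlpha p e i j)
  have hα (i j x) : D i (D j x) =
      Finsupp.linearCombination (ZMod p) (fun l => D l x) (α i j) := by
    rw [hcomp, Finsupp.linearCombination_apply, Finsupp.sum]
    simp only [hcast]
    refine finsum_eq_sum_of_support_subset _ fun l hl => ?_
    rw [Finset.mem_coe, Finsupp.mem_support_iff]
    rintro h
    refine hl ?_
    change α i j l • D l x = 0
    rw [h, zero_smul]
  induction S using Finset.induction_on with
  | empty =>
    refine ⟨Finsupp.single 0 1, fun x => by simp [h0], fun l => ?_⟩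
    have hw (m : ℕ) : (wittSumSingle p r (∅ : Finset ι)).coeff m = 0 := by
      rw [wittSumSingle, Finset.sum_empty, WittVector.zero_coeff]
    simp only [wittSumMonomial, hw, Finset.sum_empty]
    rw [Finsupp.single_apply]
    split_ifs with h
    · simp [← h]
    · obtain ⟨m, hm⟩ := Function.ne_iff.1 (Ne.symm h)
      rw [Finset.prod_eq_zero (Finset.mem_univ m) (zero_pow hm), MvPolynomial.coeff_zero]
  | insert t S ht ih =>
    obtain ⟨C, hC, hCcoeff⟩ := ih
    let Dlin : K →ₗ[ZMod p] K :=
      (AddMonoidHom.mk' (D (Pi.single r n)) (hadd _)).toZModLinearMap p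
    refine ⟨Finsupp.linearCombination (ZMod p) (α (Pi.single r n)) C, fun x => ?_, fun l' => ?_⟩
    · rw [Finset.card_insert_of_notMem ht, Function.iterate_succ_apply', hC]
      change Dlin _ = _
      rw [Finsupp.linearCombination_apply, Finsupp.linearCombination_apply _ C, map_finsuppSum,
        map_finsuppSum]
      refine Finsupp.sum_congr fun l _ => ?_
      rw [map_smul, map_smul]
      congr 1
      exact hα _ _ _
    · have hst : (∑ t ∈ S, Finsupp.single t n) t = 0 := by
        rw [Finsupp.finsetSum_apply]
        exact Finset.sum_eq_zero fun u hu =>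
          Finsupp.single_eq_of_ne (fun h => ht (h ▸ hu))
      rw [Finset.sum_insert ht, coeff_wittSumMonomial_insert p e n r S t ht _ hst C hCcoeff,
        Finsupp.linearCombination_apply, Finsupp.sum, Finsupp.finsetSum_apply]
      rfl

/-- The coefficients of the `p`-th iterate of `D (Pi.single r n)`. -/
theorem iterate_p_eq_linearCombination (p e : ℕ) [Fact p.Prime] {K : Type*} [Field K]
    [CharP K p] [Algebra (ZMod p) K] (D : (Fin e → ℕ) → K → K)
    (hadd : ∀ i x y, D i (x + y) = D i x + D i y) (h0 : D 0 = id)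
    (hcomp : ∀ i j x, D i (D j x) = ∑ᶠ l, ZMod.cast (wittAlpha p e i j l) * D l x)
    (r : Fin e) (n : ℕ) :
    ∃ C : (Fin e → ℕ) →₀ ZMod p,
      (∀ x, (D (Pi.single r n))^[p] x =
        Finsupp.linearCombination (ZMod p) (fun l => D l x) C) ∧
      ∀ l, C l = (∏ m : Fin e, (if (m : ℕ) = (r : ℕ) + 1 then
        (Polynomial.X : Polynomial (ZMod p)) ^ p else 0) ^ l m).coeff (p * n) := by
  classical
  obtain ⟨C, hC, hCcoeff⟩ := exists_iterate_eq_linearCombination p e D hadd h0 hcomp r n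
    (Finset.univ : Finset (ZMod p))
  rw [Finset.card_univ, ZMod.card] at hC
  refine ⟨C, hC, fun l => ?_⟩
  rw [hCcoeff, ← aeval_X_wittSumMonomial_univ, ← coeff_const_eq_coeff_aeval_X p _
    (rename_wittSumMonomial_univ p r e _ l)]
  congr 1
  ext a
  simp [Finsupp.finsetSum_apply, Finsupp.single_apply]

/-- In a model of `W_e`-DCF, writing `∂_{m,n} := D_{n·𝐞_m}` (here `𝐞_m` is the `m`-th standard
unit multi-index, `0`-indexed as `m : Fin e`), one has for every `n ≥ 1`:
`∂_{e,n}^(p) = 0` and `∂_{m,n}^(p) = ∂_{m+1,n}` for `m < e`. -/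
theorem WeDCF_iterate_p_single (p e : ℕ) [Fact p.Prime] (he : 1 ≤ e)
    (K : Type*) [Field K] [CharP K p] (D : (Fin e → ℕ) → K → K)
    (hD : IsWeDCF p e K D) :
    ∀ n : ℕ, 1 ≤ n →
      ((D (Pi.single (⟨e - 1, by omega⟩ : Fin e) n))^[p] = fun _ : K => 0) ∧
      (∀ m : ℕ, ∀ hm : m + 1 < e,
        (D (Pi.single (⟨m, by omega⟩ : Fin e) n))^[p] =
          D (Pi.single (⟨m + 1, hm⟩ : Fin e) n)) := by
  obtain ⟨-, -, h0, hadd, -, hcomp, -⟩ := hD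
  let := ZMod.algebra K p
  have hp : p ≠ 0 := (Fact.out : p.Prime).ne_zero
  intro n hn
  refine ⟨funext fun x => ?_, fun m hm => funext fun x => ?_⟩
  · obtain ⟨C, hC, hcoeff⟩ := iterate_p_eq_linearCombination p e D hadd h0 hcomp
      ⟨e - 1, by omega⟩ n
    have hC0 : C = 0 := by
      ext l
      have hne (m : Fin e) : (m : ℕ) ≠ e - 1 + 1 := by omega
      simp only [hcoeff, hne, if_false, Finset.prod_pow_eq_pow_sum]
      rw [zero_pow_eq]
      split_ifs
      · simpa [Polynomial.coeff_one] using ⟨hp, Nat.one_le_iff_ne_zero.1 hn⟩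
      · simp
    rw [hC, hC0, map_zero]
  · obtain ⟨C, hC, hcoeff⟩ := iterate_p_eq_linearCombination p e D hadd h0 hcomp
      ⟨m, by omega⟩ n
    have hC1 : C = Finsupp.single (Pi.single ⟨m + 1, hm⟩ n) 1 := by
      ext l
      rw [hcoeff, Finsupp.single_apply]
      by_cases hl : ∀ k, k ≠ ⟨m + 1, hm⟩ → l k = 0
      · rw [Finset.prod_eq_single (⟨m + 1, hm⟩ : Fin e) (fun k _ hk => by rw [hl k hk, pow_zero])
          (by simp), if_pos rfl, ← pow_mul, Polynomial.coeff_X_pow]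
        congr 1
        rw [Nat.mul_right_inj hp]
        refine propext ⟨fun h => funext fun k => ?_, fun h => by simp [← h]⟩
        by_cases hk : k = ⟨m + 1, hm⟩
        · subst hk; simp [h]
        · simp [hl k hk, hk]
      · push Not at hl
        obtain ⟨k, hk, hlk⟩ := hl
        have hk' : (k : ℕ) ≠ m + 1 := fun h => hk (Fin.ext h)
        rw [Finset.prod_eq_zero (Finset.mem_univ k) (by simp [hk', hlk]), Polynomial.coeff_zero,
          if_neg]
        rintro rfl
        simp [hk] at hlk
    rw [hC, hC1, Finsupp.linearCombination_single, one_smul]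
end
end

section
/- Let (K, D) be a model of W_e-DCF. Then there exists x ∈ K such that (D_{𝐞_1})^(p^e − 1)(x) ≠ 0. -/
noncomputable section

open scoped BigOperators

theorem finrank_ker_pow_le {F V : Type*} [Field F] [AddCommGroup V] [Module F V]
    [FiniteDimensional F V] (f : V →ₗ[F] V) (hf : Module.finrank F (LinearMap.ker f) ≤ 1) (n : ℕ) :
    Module.finrank F (LinearMap.ker (f ^ n)) ≤ n := by
  induction n with
  | zero => simp [Module.End.one_eq_id]
  | succ n ih =>
    set g := (f ^ n).domRestrict (LinearMap.ker (f ^ (n + 1)))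
    have hrange : LinearMap.range g ≤ LinearMap.ker f := by
      rintro _ ⟨x, rfl⟩
      exact (LinearMap.congr_fun (pow_succ' f n) (x : V)).symm.trans x.2
    have hker : (LinearMap.ker g).map (Submodule.subtype _) ≤ LinearMap.ker (f ^ n) := by
      rintro _ ⟨x, hx, rfl⟩
      exact hx
    have h₁ := g.finrank_range_add_finrank_ker
    have h₂ := Submodule.finrank_mono hrange
    have h₃ := Submodule.finrank_mono hker
    rw [Submodule.finrank_map_subtype_eq] at h₃
    omega

open MvPolynomial

/-- The embedding of the variables `x`, `y` as the `m`-th components of two Witt vectors. -/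
def componentVar (m : ℕ) (i : Fin 2) : Fin 2 × ℕ := (i, m)

theorem componentVar_injective (m : ℕ) : Function.Injective (componentVar m) :=
  fun _ _ h => congrArg Prod.fst h

/-- The components of the sum of the Witt vectors `V^m [x]` and `V^m [y]`, as integral
polynomials in `x` and `y`. -/
def teichAdd (p m k : ℕ) [Fact p.Prime] : MvPolynomial (Fin 2) ℤ :=
  killCompl (componentVar_injective m) (WittVector.wittAdd p k)

theorem killCompl_componentVar_X (m k : ℕ) (i : Fin 2) :
    killCompl (R := ℤ) (componentVar_injective m) (X (i, k)) = if k = m then X i else 0 := by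
  split_ifs with h
  · subst h
    have := killCompl_rename_app (R := ℤ) (componentVar_injective k) (X i)
    rwa [rename_X] at this
  · rw [killCompl, aeval_X, dif_neg]
    rintro ⟨j, hj⟩
    exact h (congrArg Prod.snd hj).symm

theorem sum_teichAdd (p m k : ℕ) [Fact p.Prime] :
    ∑ i ∈ Finset.range (k + 1), C ((p : ℤ) ^ i) * teichAdd p m i ^ p ^ (k - i) =
      if m ≤ k then C ((p : ℤ) ^ m) * (X 0 ^ p ^ (k - m) + X 1 ^ p ^ (k - m)) else 0 := by
  have h := congrArg (killCompl (componentVar_injective m))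
    (wittStructureInt_prop p (X 0 + X 1 : MvPolynomial (Fin 2) ℤ) k)
  have hp : ∀ n, p ^ n ≠ 0 := fun n => pow_ne_zero _ (Fact.out : p.Prime).ne_zero
  simp only [wittPolynomial_eq_sum_C_mul_X_pow, map_sum, map_add, bind₁_X_right, map_mul,
    map_pow, rename_X, algHom_C, killCompl_componentVar_X, ite_pow, zero_pow (hp _), mul_ite,
    mul_zero, Finset.sum_ite_eq', Finset.mem_range, Nat.lt_succ_iff, algebraMap_eq] at h
  simp only [teichAdd, WittVector.wittAdd, map_pow]
  rw [h]
  split_ifs <;> ring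

theorem isHomogeneous_of_C_mul {r : ℤ} (hr : r ≠ 0) {n : ℕ} {φ : MvPolynomial (Fin 2) ℤ}
    (h : (C r * φ).IsHomogeneous n) : φ.IsHomogeneous n := by
  intro d hd
  refine h ?_
  rw [coeff_C_mul]
  exact mul_ne_zero hr hd

theorem teichAdd_eq_zero (p m k : ℕ) [Fact p.Prime] (hk : k < m) : teichAdd p m k = 0 := by
  induction k using Nat.strong_induction_on with
  | _ k ih =>
    have h := sum_teichAdd p m k
    have hp : p ≠ 0 := (Fact.out : p.Prime).ne_zero
    rw [if_neg (by omega), Finset.sum_range_succ, Finset.sum_eq_zero, zero_add] at h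
    · simpa [hp] using h
    · intro i hi
      rw [Finset.mem_range] at hi
      rw [ih i hi (hi.trans hk), zero_pow (pow_ne_zero _ hp), mul_zero]

theorem teichAdd_self (p m : ℕ) [Fact p.Prime] : teichAdd p m m = X 0 + X 1 := by
  have h := sum_teichAdd p m m
  have hp : p ≠ 0 := (Fact.out : p.Prime).ne_zero
  rw [if_pos le_rfl, Finset.sum_range_succ, Finset.sum_eq_zero, zero_add] at h
  · simpa [hp] using h
  · intro i hi
    rw [teichAdd_eq_zero p m i (Finset.mem_range.1 hi), zero_pow (pow_ne_zero _ hp), mul_zero]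

theorem teichAdd_succ (p m : ℕ) [Fact p.Prime] :
    C (p : ℤ) * teichAdd p m (m + 1) = X 0 ^ p + X 1 ^ p - (X 0 + X 1) ^ p := by
  have h := sum_teichAdd p m (m + 1)
  have hp : p ≠ 0 := (Fact.out : p.Prime).ne_zero
  rw [if_pos (by omega), Finset.sum_range_succ, Finset.sum_range_succ, Finset.sum_eq_zero,
    zero_add, teichAdd_self] at h
  · simp only [Nat.add_sub_cancel_left, pow_one, Nat.sub_self, pow_zero] at h
    have hC : (C ((p : ℤ) ^ m) : MvPolynomial (Fin 2) ℤ) ≠ 0 := by simp [hp]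
    apply mul_left_cancel₀ hC
    rw [mul_sub, ← h, pow_succ, C_mul]
    ring
  · intro i hi
    rw [teichAdd_eq_zero p m i (Finset.mem_range.1 hi), zero_pow (pow_ne_zero _ hp), mul_zero]

theorem isHomogeneous_teichAdd (p m k : ℕ) [Fact p.Prime] :
    (teichAdd p m k).IsHomogeneous (p ^ (k - m)) := by
  induction k using Nat.strong_induction_on with
  | _ k ih =>
    rcases lt_or_ge k m with hk | hk
    · rw [teichAdd_eq_zero p m k hk]
      exact isHomogeneous_zero _ _ _
    have h := sum_teichAdd p m k
    have hp : p ≠ 0 := (Fact.out : p.Prime).ne_zero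
    rw [if_pos hk, Finset.sum_range_succ, ← eq_sub_iff_add_eq', Nat.sub_self, pow_zero,
      pow_one] at h
    refine isHomogeneous_of_C_mul (pow_ne_zero k (Int.natCast_ne_zero.2 hp)) ?_
    rw [h]
    refine IsHomogeneous.sub (IsHomogeneous.C_mul
      ((isHomogeneous_X_pow _ _).add (isHomogeneous_X_pow _ _)) _) (IsHomogeneous.sum _ _ _ ?_)
    intro i hi
    rw [Finset.mem_range] at hi
    rcases lt_or_ge i m with him | him
    · rw [teichAdd_eq_zero p m i him, zero_pow (pow_ne_zero _ hp), mul_zero]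
      exact isHomogeneous_zero _ _ _
    · have := ((ih i hi).pow (p ^ (k - i))).C_mul ((p : ℤ) ^ i)
      rwa [← pow_add, show i - m + (k - i) = k - m by omega] at this

/-- The exponent of the monomial `x ^ (n - 1) * y`. -/
def nearPowerExp (n : ℕ) : Fin 2 →₀ ℕ := Finsupp.single 0 (n - 1) + Finsupp.single 1 1

theorem coeff_nearPowerExp_X_pow {R : Type*} [CommRing R] {n : ℕ} (hn : 2 ≤ n) (i : Fin 2) :
    coeff (nearPowerExp n) (X i ^ n : MvPolynomial (Fin 2) R) = 0 := by
  classical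
  rw [coeff_X_pow, if_neg]
  intro h
  have h₀ := DFunLike.congr_fun h 0
  have h₁ := DFunLike.congr_fun h 1
  fin_cases i
  · simp [nearPowerExp] at h₁
  · simp [nearPowerExp] at h₀ h₁
    omega

theorem coeff_nearPowerExp_add_pow {R : Type*} [CommRing R] {n : ℕ} (hn : 1 ≤ n) :
    coeff (nearPowerExp n) ((X 0 + X 1) ^ n : MvPolynomial (Fin 2) R) = n := by
  classical
  have hterm : ∀ k, (X 0 ^ k * X 1 ^ (n - k) * (n.choose k : MvPolynomial (Fin 2) R)) =
      monomial (Finsupp.single 0 k + Finsupp.single 1 (n - k)) (n.choose k : R) := by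
    intro k
    rw [X_pow_eq_monomial, X_pow_eq_monomial, monomial_mul, ← map_natCast C, mul_comm,
      C_mul_monomial]
    simp
  rw [add_pow, coeff_sum, Finset.sum_eq_single (n - 1)]
  · rw [hterm, coeff_monomial, if_pos, Nat.choose_symm hn, Nat.choose_one_right]
    rw [nearPowerExp, Nat.sub_sub_self hn]
  · intro k _ hk
    rw [hterm, coeff_monomial, if_neg]
    intro h
    have := DFunLike.congr_fun h 0
    simp [nearPowerExp] at this
    exact hk this
  · intro h
    exact absurd (Finset.mem_range.2 (by omega)) h

theorem coeff_nearPowerExp_teichAdd_succ (p m : ℕ) [Fact p.Prime] :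
    coeff (nearPowerExp p) (teichAdd p m (m + 1)) = -1 := by
  have hp : p.Prime := Fact.out
  have h := congrArg (coeff (nearPowerExp p)) (teichAdd_succ p m)
  rw [coeff_C_mul, coeff_sub, coeff_add, coeff_nearPowerExp_X_pow hp.two_le,
    coeff_nearPowerExp_X_pow hp.two_le, coeff_nearPowerExp_add_pow hp.one_le] at h
  have hp' : (p : ℤ) ≠ 0 := Int.natCast_ne_zero.2 hp.ne_zero
  apply mul_left_cancel₀ hp'
  rw [h]
  ring

theorem xyExp_single (e : ℕ) (m : Fin e) (n : ℕ) :
    xyExp e (Pi.single m (n - 1)) (Pi.single m 1) =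
      (nearPowerExp n).mapDomain (componentVar m) := by
  rw [xyExp, Finset.sum_eq_single m]
  · rw [nearPowerExp, Finsupp.mapDomain_add, Finsupp.mapDomain_single, Finsupp.mapDomain_single,
      Pi.single_eq_same, Pi.single_eq_same]
    rfl
  · intro k _ hk
    rw [Pi.single_eq_of_ne hk, Pi.single_eq_of_ne hk]
    simp
  · simp

theorem wittAlpha_single (p e : ℕ) [Fact p.Prime] (m : Fin e) (l : Fin e → ℕ) :
    wittAlpha p e (Pi.single m (p - 1)) (Pi.single m 1) l =
      coeff (nearPowerExp p)
        (∏ k : Fin e, (map (Int.castRingHom (ZMod p)) (teichAdd p m k)) ^ l k) := by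
  rw [wittAlpha, xyExp_single, ← coeff_killCompl (componentVar_injective m), map_prod]
  simp only [map_pow, wittHmod, killCompl_map, teichAdd]

theorem degree_nearPowerExp {n : ℕ} (hn : 1 ≤ n) : (nearPowerExp n).degree = n := by
  rw [nearPowerExp, map_add, Finsupp.degree_single, Finsupp.degree_single]
  omega

theorem coeff_nearPowerExp_prod_teichAdd (p e : ℕ) [Fact p.Prime] (m m' : Fin e)
    (hm : (m' : ℕ) = m + 1) (l : Fin e → ℕ) (hl : l ≠ Pi.single m' 1) :
    coeff (nearPowerExp p)
      (∏ k : Fin e, (map (Int.castRingHom (ZMod p)) (teichAdd p m k)) ^ l k) = 0 := by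
  have hp : p.Prime := Fact.out
  by_contra hne
  have hlow : ∀ k : Fin e, k < m → l k = 0 := by
    intro k hk
    by_contra hlk
    apply hne
    rw [Finset.prod_eq_zero (Finset.mem_univ k), coeff_zero]
    rw [teichAdd_eq_zero p m k hk, map_zero, zero_pow hlk]
  have hdeg : ∑ k : Fin e, p ^ ((k : ℕ) - m) * l k = p := by
    by_contra hd
    apply hne
    refine IsHomogeneous.coeff_eq_zero (n := ∑ k : Fin e, p ^ ((k : ℕ) - m) * l k)
      (IsHomogeneous.prod _ _ _ fun k _ =>
        IsHomogeneous.pow ((isHomogeneous_teichAdd p m k).map _) _) ?_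
    rw [degree_nearPowerExp hp.one_le]
    exact Ne.symm hd
  have hle : ∀ k : Fin e, p ^ ((k : ℕ) - m) * l k ≤ p := fun k =>
    (Finset.single_le_sum (f := fun k : Fin e => p ^ ((k : ℕ) - m) * l k)
      (fun _ _ => Nat.zero_le _) (Finset.mem_univ k)).trans hdeg.le
  have hhigh : ∀ k : Fin e, m' < k → l k = 0 := by
    intro k hk
    by_contra hlk
    have hk' : (m' : ℕ) < k := hk
    have h₁ : p ^ 2 ≤ p ^ ((k : ℕ) - m) := Nat.pow_le_pow_right hp.pos (by omega)
    have h₂ : p ^ ((k : ℕ) - m) * 1 ≤ p ^ ((k : ℕ) - m) * l k :=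
      Nat.mul_le_mul_left _ (Nat.one_le_iff_ne_zero.2 hlk)
    have h₃ := hle k
    nlinarith [hp.two_le]
  have hmm : m ≠ m' := fun h => by rw [h] at hm; omega
  have hother : ∀ k, k ≠ m → k ≠ m' → l k = 0 := by
    intro k hk hk'
    rcases lt_or_gt_of_ne hk with h | h
    · exact hlow k h
    · refine hhigh k (lt_of_le_of_ne ?_ (Ne.symm hk'))
      have : (m : ℕ) < k := h
      exact Fin.le_def.2 (by omega)
  rw [Fintype.sum_eq_add m m' hmm
    (fun k hk => by rw [hother k hk.1 hk.2, mul_zero])] at hdeg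
  rw [hm, Nat.sub_self, Nat.add_sub_cancel_left, pow_zero, one_mul, pow_one] at hdeg
  have hm'0 : l m' = 0 := by
    by_contra h0
    have h1 : l m' = 1 := by
      have : p * l m' ≤ p * 1 := by omega
      have := Nat.le_of_mul_le_mul_left this hp.pos
      omega
    rw [h1] at hdeg
    apply hl
    funext k
    by_cases hk' : k = m'
    · rw [hk', h1, Pi.single_eq_same]
    rw [Pi.single_eq_of_ne hk']
    by_cases hk : k = m
    · rw [hk]; omega
    · exact hother k hk hk'
  apply hne
  rw [Finset.prod_eq_single m]
  · rw [hm'0, mul_zero, add_zero] at hdeg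
    rw [hdeg, teichAdd_self, map_add, map_X, map_X, coeff_nearPowerExp_add_pow hp.one_le,
      CharP.cast_eq_zero]
  · intro k _ hk
    have : l k = 0 := by
      by_cases hk' : k = m'
      · rw [hk', hm'0]
      · exact hother k hk hk'
    rw [this, pow_zero]
  · simp

theorem wittAlpha_single_eq_ite (p e : ℕ) [Fact p.Prime] (m m' : Fin e)
    (hm : (m' : ℕ) = m + 1) (l : Fin e → ℕ) :
    wittAlpha p e (Pi.single m (p - 1)) (Pi.single m 1) l =
      if l = Pi.single m' 1 then -1 else 0 := by
  rw [wittAlpha_single]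
  split_ifs with hl
  · rw [hl, Finset.prod_eq_single m', Pi.single_eq_same, pow_one, coeff_map, hm,
      coeff_nearPowerExp_teichAdd_succ]
    · simp
    · intro k _ hk
      rw [Pi.single_eq_of_ne hk, pow_zero]
    · simp
  · exact coeff_nearPowerExp_prod_teichAdd p e m m' hm l hl

theorem IsWeDCF.map_single_succ_eq_zero {p e : ℕ} [Fact p.Prime] {K : Type*} [Field K] [CharP K p]
    {D : (Fin e → ℕ) → K → K} (hD : IsWeDCF p e K D) {m m' : Fin e} (hm : (m' : ℕ) = m + 1)
    {x : K} (hx : D (Pi.single m 1) x = 0) : D (Pi.single m' 1) x = 0 := by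
  obtain ⟨-, -, -, hadd, -, hiter, -⟩ := hD
  have h := hiter (Pi.single m (p - 1)) (Pi.single m 1) x
  have hzero : D (Pi.single m (p - 1)) 0 = 0 := by
    simpa using hadd (Pi.single m (p - 1)) 0 0
  rw [hx, hzero, finsum_eq_single _ (Pi.single m' 1)] at h
  · rw [wittAlpha_single_eq_ite p e m m' hm, if_pos rfl, ZMod.cast_neg dvd_rfl,
      ZMod.cast_one dvd_rfl, neg_one_mul] at h
    exact neg_eq_zero.1 h.symm
  · intro l hl
    rw [wittAlpha_single_eq_ite p e m m' hm, if_neg hl, ZMod.cast_zero, zero_mul]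

theorem IsWeDCF.eq_pow_of_map_single_eq_zero {p e : ℕ} [Fact p.Prime] (he : 1 ≤ e) {K : Type*}
    [Field K] [CharP K p] {D : (Fin e → ℕ) → K → K} (hD : IsWeDCF p e K D) {x : K}
    (hx : D (Pi.single (⟨0, he⟩ : Fin e) 1) x = 0) : ∃ y : K, x = y ^ p := by
  refine (hD.2.2.2.2.2.2 x).1 fun ⟨m, hm⟩ => ?_
  induction m with
  | zero => exact hx
  | succ m ih => exact hD.map_single_succ_eq_zero (m := ⟨m, by omega⟩) rfl (ih (by omega))

theorem IsWeDCF.map_single_mul {p e : ℕ} [Fact p.Prime] {K : Type*} [Field K] [CharP K p]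
    {D : (Fin e → ℕ) → K → K} (hD : IsWeDCF p e K D) (m : Fin e) (x y : K) :
    D (Pi.single m 1) (x * y) = x * D (Pi.single m 1) y + D (Pi.single m 1) x * y := by
  obtain ⟨-, -, hzero, -, hmul, -, -⟩ := hD
  have hIic : Finset.Iic (Pi.single m 1 : Fin e → ℕ) = {0, Pi.single m 1} := by
    ext k
    simp only [Finset.mem_Iic, Finset.mem_insert, Finset.mem_singleton]
    constructor
    · intro hk
      have hoff : ∀ n, n ≠ m → k n = 0 := fun n hn => by
        have := hk n
        rw [Pi.single_eq_of_ne hn] at this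
        exact Nat.le_zero.1 this
      have hon : k m ≤ 1 := by simpa using hk m
      rcases Nat.le_one_iff_eq_zero_or_eq_one.1 hon with h | h
      · left
        funext n
        by_cases hn : n = m
        · rw [hn, h]; rfl
        · exact hoff n hn
      · right
        funext n
        by_cases hn : n = m
        · rw [hn, h, Pi.single_eq_same]
        · rw [hoff n hn, Pi.single_eq_of_ne hn]
    · rintro (rfl | rfl)
      · exact fun _ => Nat.zero_le _
      · exact le_rfl
  rw [hmul, hIic, Finset.sum_pair, hzero, tsub_zero, tsub_self, hzero]
  · rfl
  · intro h
    simpa using congrFun h m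

/-- The operator `D_{𝐞_m}` as a `K^p`-linear endomorphism of `K`. -/
def IsWeDCF.linearMap {p e : ℕ} [Fact p.Prime] {K : Type*} [Field K] [CharP K p]
    {D : (Fin e → ℕ) → K → K} (hD : IsWeDCF p e K D) (m : Fin e) :
    K →ₗ[(frobenius K p).fieldRange] K where
  toFun := D (Pi.single m 1)
  map_add' := hD.2.2.2.1 _
  map_smul' := by
    rintro ⟨_, y, rfl⟩ x
    have hy : D (Pi.single m 1) (frobenius K p y) = 0 :=
      (hD.2.2.2.2.2.2 _).2 ⟨y, rfl⟩ m
    change D (Pi.single m 1) (frobenius K p y * x) = frobenius K p y * D (Pi.single m 1) x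
    rw [hD.map_single_mul, hy, zero_mul, add_zero]

/-- In a model of `W_e`-DCF there exists `x` with `(D_{𝐞_1})^(p^e − 1)(x) ≠ 0`. -/
theorem WeDCF_exists_iterate_ne_zero (p e : ℕ) [Fact p.Prime] (he : 1 ≤ e)
    (K : Type*) [Field K] [CharP K p] (D : (Fin e → ℕ) → K → K)
    (hD : IsWeDCF p e K D) :
    ∃ x : K, (D (Pi.single (⟨0, he⟩ : Fin e) 1))^[p ^ e - 1] x ≠ 0 := by
  by_contra! hall
  have hpos : 0 < p ^ e := pow_pos (Fact.out : p.Prime).pos e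
  have hrank : Module.finrank (frobenius K p).fieldRange K = p ^ e := hD.2.1
  have : FiniteDimensional (frobenius K p).fieldRange K :=
    Module.finite_of_finrank_pos (hrank ▸ hpos)
  set f := hD.linearMap ⟨0, he⟩
  have hker : Module.finrank (frobenius K p).fieldRange (LinearMap.ker f) ≤ 1 := by
    refine finrank_le_one (⟨1, (hD.2.2.2.2.2.2 1).2 ⟨1, (one_pow p).symm⟩ _⟩ : LinearMap.ker f) ?_
    rintro ⟨x, hx⟩
    obtain ⟨y, rfl⟩ := hD.eq_pow_of_map_single_eq_zero he hx
    exact ⟨⟨frobenius K p y, y, rfl⟩, Subtype.ext (mul_one _)⟩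
  have htop : LinearMap.ker (f ^ (p ^ e - 1)) = ⊤ := by
    refine LinearMap.ker_eq_top.2 (LinearMap.ext fun x => ?_)
    rw [Module.End.pow_apply]
    exact hall x
  have := finrank_ker_pow_le f hker (p ^ e - 1)
  rw [htop, finrank_top, hrank] at this
  omega
end
end
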